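/- Let q be a real number with 0 < q < 1, let m be a positive rational number and ν a rational number. Then ∑_{i,j,k ≥ 0} q^{2m(i−j)² + (i+j)² + 2k² − 2(i+j)k + ν(i−j)} / ((q⁴;q⁴)_i (q⁴;q⁴)_j (q⁴;q⁴)_k) = J_4³ J̄_{2(4m+ν+1), 4(4m+1)} / (J_2² J_8²) + 2 q^{2m+ν+1} J_8² J̄_{−2ν, 4(4m+1)} / J_4³. -/

import Mathlib

open scoped BigOperators Topology Real

/-- Finite q-Pochhammer symbol `(a;q)_n = ∏_{k=0}^{n-1} (1 - a q^k)`. -/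
noncomputable def qPochFinR (a q : ℝ) (n : ℕ) : ℝ := ∏ k ∈ Finset.range n, (1 - a * q ^ k)

/-- Infinite q-Pochhammer symbol `(a;q)_∞ = ∏_{k=0}^{∞} (1 - a q^k)`. -/
noncomputable def qPochInfR (a q : ℝ) : ℝ := ∏' k : ℕ, (1 - a * q ^ k)

/-- `J_m = (q^m; q^m)_∞` with `q^m` the real power of `q`. -/
noncomputable def JR (q m : ℝ) : ℝ := qPochInfR (q ^ m) (q ^ m)

/-- `J_{a,m} = (q^a;q^m)_∞ (q^{m-a};q^m)_∞ (q^m;q^m)_∞` with real powers of `q`. -/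
noncomputable def JamR (q a m : ℝ) : ℝ :=
  qPochInfR (q ^ a) (q ^ m) * qPochInfR (q ^ (m - a)) (q ^ m) * qPochInfR (q ^ m) (q ^ m)

/-- `J̄_{a,m} = (-q^a;q^m)_∞ (-q^{m-a};q^m)_∞ (q^m;q^m)_∞` with real powers of `q`. -/
noncomputable def JbarR (q a m : ℝ) : ℝ :=
  qPochInfR (-(q ^ a)) (q ^ m) * qPochInfR (-(q ^ (m - a))) (q ^ m) * qPochInfR (q ^ m) (q ^ m)

section QSeries
open Filter

variable {Q : ℝ}

theorem multipliable_one_sub_mul_pow (h0 : 0 < Q) (h1 : Q < 1) (a : ℝ) :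
    Multipliable fun k : ℕ => 1 - a * Q ^ k := by
  have : Summable fun k : ℕ => ‖-(a * Q ^ k)‖ :=
    ((summable_geometric_of_lt_one h0.le h1).mul_left a).neg.norm
  simpa [sub_eq_add_neg] using multipliable_one_add_of_summable this

theorem tendsto_qPochFinR (h0 : 0 < Q) (h1 : Q < 1) (a : ℝ) :
    Tendsto (qPochFinR a Q) atTop (𝓝 (qPochInfR a Q)) :=
  (multipliable_one_sub_mul_pow h0 h1 a).hasProd.tendsto_prod_nat

theorem qPochFinR_succ (a : ℝ) (n : ℕ) :
    qPochFinR a Q (n + 1) = qPochFinR a Q n * (1 - a * Q ^ n) :=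
  Finset.prod_range_succ _ _

theorem qPochFinR_succ' (a : ℝ) (n : ℕ) :
    qPochFinR a Q (n + 1) = (1 - a) * qPochFinR (a * Q) Q n := by
  unfold qPochFinR
  rw [Finset.prod_range_succ', mul_comm]
  simp only [pow_zero, mul_one]
  congr 1
  exact Finset.prod_congr rfl fun k _ => by ring

theorem qPochInfR_step (h0 : 0 < Q) (h1 : Q < 1) (a : ℝ) :
    qPochInfR a Q = (1 - a) * qPochInfR (a * Q) Q := by
  refine tendsto_nhds_unique ((tendsto_add_atTop_iff_nat 1).2 (tendsto_qPochFinR h0 h1 a)) ?_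
  simp only [qPochFinR_succ']
  exact (tendsto_qPochFinR h0 h1 _).const_mul _

theorem qPochInfR_split (h0 : 0 < Q) (h1 : Q < 1) (a : ℝ) (n : ℕ) :
    qPochInfR a Q = qPochFinR a Q n * qPochInfR (a * Q ^ n) Q := by
  induction n with
  | zero => simp [qPochFinR]
  | succ n ih => rw [ih, qPochFinR_succ, qPochInfR_step h0 h1 (a * Q ^ n)]; ring_nf

theorem qPochFinR_pos (h0 : 0 < Q) (h1 : Q < 1) {a : ℝ} (ha : a < 1) (n : ℕ) :
    0 < qPochFinR a Q n := by
  refine Finset.prod_pos fun k _ => ?_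
  have hk : 0 < Q ^ k := pow_pos h0 k
  have hk' : Q ^ k ≤ 1 := pow_le_one₀ h0.le h1.le
  nlinarith

theorem qPochInfR_pos (h0 : 0 < Q) (h1 : Q < 1) {a : ℝ} (ha : a < 1) :
    0 < qPochInfR a Q := by
  have hne : qPochInfR a Q ≠ 0 := by
    have hs : Summable fun k : ℕ => ‖-(a * Q ^ k)‖ :=
      ((summable_geometric_of_lt_one h0.le h1).mul_left a).neg.norm
    have := tprod_one_add_ne_zero_of_summable (f := fun k : ℕ => -(a * Q ^ k)) (fun k => by
      have hk : 0 < Q ^ k := pow_pos h0 k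
      have hk' : Q ^ k ≤ 1 := pow_le_one₀ h0.le h1.le
      nlinarith) hs
    simpa [qPochInfR, sub_eq_add_neg] using this
  exact lt_of_le_of_ne (ge_of_tendsto' (tendsto_qPochFinR h0 h1 a)
    fun n => (qPochFinR_pos h0 h1 ha n).le) hne.symm

/-- The `j`-th term of the `₁φ₁` series
`∑ (-α/β;Q)_j Q^{j(j-1)/2} (βγ)^j / ((Q;Q)_j (αγ;Q)_j)`, written so that it makes sense for
`β = 0`. -/
noncomputable def phiTerm (Q α β γ : ℝ) (j : ℕ) : ℝ :=
  ∏ k ∈ Finset.range j,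
    ((β + α * Q ^ k) * Q ^ k * γ / ((1 - Q ^ (k + 1)) * (1 - α * γ * Q ^ k)))

theorem phiTerm_succ (Q α β γ : ℝ) (j : ℕ) :
    phiTerm Q α β γ (j + 1) = phiTerm Q α β γ j *
      ((β + α * Q ^ j) * Q ^ j * γ / ((1 - Q ^ (j + 1)) * (1 - α * γ * Q ^ j))) :=
  Finset.prod_range_succ _ _

variable {α β γ : ℝ}

theorem one_sub_mul_pow_pos (h0 : 0 < Q) (h1 : Q < 1) {a : ℝ} (ha : a < 1) (k : ℕ) :
    0 < 1 - a * Q ^ k := by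
  have hk : 0 < Q ^ k := pow_pos h0 k
  have hk' : Q ^ k ≤ 1 := pow_le_one₀ h0.le h1.le
  nlinarith

theorem one_sub_pow_succ_pos (h0 : 0 < Q) (h1 : Q < 1) (k : ℕ) : 0 < 1 - Q ^ (k + 1) :=
  sub_pos.2 (pow_lt_one₀ h0.le h1 k.succ_ne_zero)

theorem phiTerm_nonneg (h0 : 0 < Q) (h1 : Q < 1) (hα : 0 ≤ α) (hβ : 0 ≤ β) (hγ : 0 ≤ γ)
    (h : α * γ < 1) (j : ℕ) : 0 ≤ phiTerm Q α β γ j := by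
  refine Finset.prod_nonneg fun k _ => ?_
  have := one_sub_mul_pow_pos h0 h1 h k
  have := one_sub_pow_succ_pos h0 h1 k
  positivity

theorem summable_phiTerm (h0 : 0 < Q) (h1 : Q < 1) : Summable (phiTerm Q α β γ) := by
  have hQ : Tendsto (fun k : ℕ => Q ^ k) atTop (𝓝 0) :=
    tendsto_pow_atTop_nhds_zero_of_lt_one h0.le h1
  have hlim : Tendsto (fun k : ℕ => ‖(β + α * Q ^ k) * Q ^ k * γ /
      ((1 - Q ^ (k + 1)) * (1 - α * γ * Q ^ k))‖) atTop (𝓝 0) := by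
    have hQ' := (tendsto_add_atTop_iff_nat 1).2 hQ
    have := ((((hQ.const_mul α).const_add β).mul hQ).mul_const γ).div
      ((hQ'.const_sub 1).mul ((hQ.const_mul (α * γ)).const_sub 1)) (by simp)
    simpa using this.norm
  refine summable_of_ratio_norm_eventually_le (r := 1 / 2) (by norm_num) ?_
  filter_upwards [hlim.eventually (ge_mem_nhds (show (0 : ℝ) < 1 / 2 by norm_num))] with k hk
  rw [phiTerm_succ, norm_mul, mul_comm]
  exact mul_le_mul_of_nonneg_right hk (norm_nonneg _)

theorem phiTerm_shift (h0 : 0 < Q) (h1 : Q < 1)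
    (h : α * γ < 1) (j : ℕ) :
    phiTerm Q α β (γ * Q) j * (1 - α * γ * Q ^ j) = (1 - α * γ) * Q ^ j * phiTerm Q α β γ j := by
  induction j with
  | zero => simp [phiTerm]
  | succ j ih =>
    have e1 := (one_sub_mul_pow_pos h0 h1 h j).ne'
    have e2 := (one_sub_mul_pow_pos h0 h1 h (j + 1)).ne'
    have e3 := (one_sub_pow_succ_pos h0 h1 j).ne'
    have e4 : 1 - α * (γ * Q) * Q ^ j = 1 - α * γ * Q ^ (j + 1) := by ring
    rw [phiTerm_succ, phiTerm_succ, e4, eq_div_of_mul_eq e1 ih, pow_succ Q j]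
    rw [pow_succ] at e2 e3
    generalize 1 - α * γ * Q ^ j = X at *
    generalize 1 - α * γ * (Q ^ j * Q) = Y at *
    generalize 1 - Q ^ j * Q = Z at *
    field_simp

theorem phiTerm_telescope (h0 : 0 < Q) (h1 : Q < 1)
    (h : α * γ < 1) (N : ℕ) :
    (1 - α * γ) * ∑ j ∈ Finset.range N, phiTerm Q α β γ j -
      (1 + β * γ) * ∑ j ∈ Finset.range N, phiTerm Q α β (γ * Q) j =
      -((1 - α * γ) * phiTerm Q α β γ N * (1 - Q ^ N)) := by
  induction N with
  | zero => simp
  | succ N ih =>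
    have e1 := (one_sub_mul_pow_pos h0 h1 h N).ne'
    have e3 := (one_sub_pow_succ_pos h0 h1 N).ne'
    have hs := phiTerm_shift (β := β) h0 h1 h N
    have hs' : phiTerm Q α β (γ * Q) N =
        (1 - α * γ) * Q ^ N * phiTerm Q α β γ N / (1 - α * γ * Q ^ N) := by
      rw [eq_div_iff e1, hs]
    rw [Finset.sum_range_succ, Finset.sum_range_succ, mul_add, mul_add, phiTerm_succ]
    have : ∀ a b c d : ℝ, a + b - (c + d) = (a - c) + (b - d) := by intros; ring
    rw [this, ih, hs']
    field_simp
    ring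

theorem phi_functional (h0 : 0 < Q) (h1 : Q < 1)
    (h : α * γ < 1) :
    (1 - α * γ) * ∑' j, phiTerm Q α β γ j = (1 + β * γ) * ∑' j, phiTerm Q α β (γ * Q) j := by
  have s1 := summable_phiTerm (α := α) (β := β) (γ := γ) h0 h1
  have s2 := summable_phiTerm (α := α) (β := β) (γ := γ * Q) h0 h1
  have hQ : Tendsto (fun k : ℕ => Q ^ k) atTop (𝓝 0) :=
    tendsto_pow_atTop_nhds_zero_of_lt_one h0.le h1
  have l1 := (s1.hasSum.tendsto_sum_nat.const_mul (1 - α * γ)).sub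
    (s2.hasSum.tendsto_sum_nat.const_mul (1 + β * γ))
  have l2 := ((s1.tendsto_atTop_zero.const_mul (1 - α * γ)).mul (hQ.const_sub 1)).neg
  simp only [phiTerm_telescope h0 h1 h] at l1
  have := tendsto_nhds_unique l1 l2
  linarith

theorem phiTerm_scale_le (h0 : 0 < Q) (h1 : Q < 1) (hα : 0 ≤ α) (hβ : 0 ≤ β) (hγ : 0 ≤ γ)
    (h : α * γ < 1) {c : ℝ} (hc0 : 0 ≤ c) (hc1 : c ≤ 1) (j : ℕ) :
    phiTerm Q α β (γ * c) j ≤ phiTerm Q α β γ j ∧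
      phiTerm Q α β (γ * c) (j + 1) ≤ c * phiTerm Q α β γ (j + 1) := by
  have hle : α * (γ * c) ≤ α * γ := by
    rw [← mul_assoc]; exact mul_le_of_le_one_right (by positivity) hc1
  have h' : α * (γ * c) < 1 := hle.trans_lt h
  have ratio : ∀ k : ℕ,
      (β + α * Q ^ k) * Q ^ k * (γ * c) / ((1 - Q ^ (k + 1)) * (1 - α * (γ * c) * Q ^ k)) ≤
      c * ((β + α * Q ^ k) * Q ^ k * γ / ((1 - Q ^ (k + 1)) * (1 - α * γ * Q ^ k))) := by
    intro k
    have p1 := one_sub_mul_pow_pos h0 h1 h k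
    have p2 := one_sub_mul_pow_pos h0 h1 h' k
    have p3 := one_sub_pow_succ_pos h0 h1 k
    have : c * ((β + α * Q ^ k) * Q ^ k * γ / ((1 - Q ^ (k + 1)) * (1 - α * γ * Q ^ k))) =
      (β + α * Q ^ k) * Q ^ k * (γ * c) / ((1 - Q ^ (k + 1)) * (1 - α * γ * Q ^ k)) := by ring
    rw [this]
    gcongr
  have first : ∀ j : ℕ, phiTerm Q α β (γ * c) j ≤ phiTerm Q α β γ j := by
    intro j
    refine Finset.prod_le_prod (fun k _ => ?_) fun k _ => (ratio k).trans ?_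
    · have p2 := one_sub_mul_pow_pos h0 h1 h' k
      have p3 := one_sub_pow_succ_pos h0 h1 k
      positivity
    · have p2 := one_sub_mul_pow_pos h0 h1 h k
      have p3 := one_sub_pow_succ_pos h0 h1 k
      exact mul_le_of_le_one_left (by positivity) hc1
  refine ⟨first j, ?_⟩
  rw [phiTerm_succ, phiTerm_succ]
  have p2 := one_sub_mul_pow_pos h0 h1 h' j
  have p3 := one_sub_pow_succ_pos h0 h1 j
  exact (mul_le_mul (first j) (ratio j) (by positivity)
    (phiTerm_nonneg h0 h1 hα hβ hγ h j)).trans_eq (mul_left_comm _ _ _)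

theorem phi_iterate (h0 : 0 < Q) (h1 : Q < 1) (hα : 0 ≤ α) (hγ : 0 ≤ γ)
    (h : α * γ < 1) (n : ℕ) :
    qPochFinR (α * γ) Q n * ∑' j, phiTerm Q α β γ j =
      qPochFinR (-(β * γ)) Q n * ∑' j, phiTerm Q α β (γ * Q ^ n) j := by
  induction n with
  | zero => simp [qPochFinR]
  | succ n ih =>
    have hQ : Q ^ n ≤ 1 := pow_le_one₀ h0.le h1.le
    have hQ0 : 0 < Q ^ n := pow_pos h0 n
    have h' : α * (γ * Q ^ n) < 1 := by
      have : α * γ * Q ^ n ≤ α * γ := mul_le_of_le_one_right (by positivity) hQ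
      nlinarith
    have hf := phi_functional (β := β) h0 h1 h'
    rw [mul_assoc γ, ← pow_succ] at hf
    rw [qPochFinR_succ, qPochFinR_succ]
    linear_combination (1 - α * γ * Q ^ n) * ih + qPochFinR (-(β * γ)) Q n * hf

theorem hasSum_phiTerm (h0 : 0 < Q) (h1 : Q < 1) (hα : 0 ≤ α) (hβ : 0 ≤ β) (hγ : 0 ≤ γ)
    (h : α * γ < 1) :
    HasSum (phiTerm Q α β γ) (qPochInfR (-(β * γ)) Q / qPochInfR (α * γ) Q) := by
  have hQ : Tendsto (fun k : ℕ => Q ^ k) atTop (𝓝 0) :=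
    tendsto_pow_atTop_nhds_zero_of_lt_one h0.le h1
  have hs := summable_phiTerm (α := α) (β := β) (γ := γ) h0 h1
  have hlim : Tendsto (fun n : ℕ => ∑' j, phiTerm Q α β (γ * Q ^ n) j) atTop (𝓝 1) := by
    have hup : Tendsto (fun n : ℕ => 1 + Q ^ n * ∑' j, phiTerm Q α β γ (j + 1)) atTop (𝓝 1) := by
      simpa using (hQ.mul_const (∑' j, phiTerm Q α β γ (j + 1))).const_add 1
    have key : ∀ n : ℕ, ∑' j, phiTerm Q α β (γ * Q ^ n) j =
        1 + ∑' j, phiTerm Q α β (γ * Q ^ n) (j + 1) := fun n => by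
      rw [(summable_phiTerm h0 h1).tsum_eq_zero_add]; simp [phiTerm]
    refine tendsto_of_tendsto_of_tendsto_of_le_of_le tendsto_const_nhds hup (fun n => ?_)
      fun n => ?_
    · have hQ1 : Q ^ n ≤ 1 := pow_le_one₀ h0.le h1.le
      have hQ0 : 0 < Q ^ n := pow_pos h0 n
      have h' : α * (γ * Q ^ n) < 1 := by
        have : α * γ * Q ^ n ≤ α * γ := mul_le_of_le_one_right (by positivity) hQ1
        nlinarith
      simp only [key]
      exact le_add_of_nonneg_right
        (tsum_nonneg fun j => phiTerm_nonneg h0 h1 hα hβ (by positivity) h' _)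
    · simp only [key]
      rw [← tsum_mul_left]
      refine add_le_add le_rfl ?_
      refine Summable.tsum_le_tsum (fun j => ?_) ((summable_nat_add_iff 1).2
        (summable_phiTerm h0 h1)) (((summable_nat_add_iff 1).2 hs).mul_left _)
      exact (phiTerm_scale_le h0 h1 hα hβ hγ h (pow_pos h0 n).le (pow_le_one₀ h0.le h1.le) j).2
  have l1 := (tendsto_qPochFinR h0 h1 (α * γ)).mul_const (∑' j, phiTerm Q α β γ j)
  have l2 := (tendsto_qPochFinR h0 h1 (-(β * γ))).mul hlim
  simp only [phi_iterate h0 h1 hα hγ h] at l1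
  have := tendsto_nhds_unique l1 l2
  have e : ∑' j, phiTerm Q α β γ j = qPochInfR (-(β * γ)) Q / qPochInfR (α * γ) Q := by
    rw [eq_div_iff (qPochInfR_pos h0 h1 h).ne']
    linarith
  exact e ▸ hs.hasSum

end QSeries

section DoubleSums
open Filter

theorem hasSum_prod_of_nonneg {ι κ : Type*} {f : ι × κ → ℝ} {g : ι → ℝ} {s : ℝ} (hf : 0 ≤ f)
    (hg : ∀ i, HasSum (fun k => f (i, k)) (g i)) (hs : HasSum g s) : HasSum f s := by
  have hsum : Summable f := (summable_prod_of_nonneg hf).2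
    ⟨fun i => (hg i).summable, by simpa only [(hg _).tsum_eq] using hs.summable⟩
  have := (hsum.hasSum.prod_fiberwise hg).unique hs
  exact this ▸ hsum.hasSum

/-- Pairs of naturals parametrised by their difference and their minimum. -/
def diffMinEquiv : ℤ × ℕ ≃ ℕ × ℕ where
  toFun p := (p.2 + p.1.toNat, p.2 + (-p.1).toNat)
  invFun p := ((p.1 : ℤ) - p.2, min p.1 p.2)
  left_inv p := by
    rcases p with ⟨d, t⟩
    ext <;> simp
    omega
  right_inv p := by
    rcases p with ⟨i, j⟩
    ext <;> simp <;> omega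

theorem hasSum_int_of_even_odd {f : ℤ → ℝ} {a b : ℝ} (h0 : HasSum (fun n => f (2 * n)) a)
    (h1 : HasSum (fun n => f (1 - 2 * n)) b) : HasSum f (a + b) := by
  have i0 : Function.Injective fun n : ℤ => 2 * n := fun x y h => by simpa using h
  have i1 : Function.Injective fun n : ℤ => 1 - 2 * n := fun x y h => by simpa using h
  refine HasSum.add_isCompl (s := Set.range fun n : ℤ => 2 * n)
    (t := Set.range fun n : ℤ => 1 - 2 * n) ?_ (i0.hasSum_range_iff.2 h0) (i1.hasSum_range_iff.2 h1)
  convert Int.isCompl_even_odd using 1 <;> ext n <;> simp only [Set.mem_range, Set.mem_ofPred_eq]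
  · exact ⟨fun ⟨k, hk⟩ => ⟨k, by omega⟩, fun ⟨k, hk⟩ => ⟨k, by omega⟩⟩
  · exact ⟨fun ⟨k, hk⟩ => ⟨-k, by omega⟩, fun ⟨k, hk⟩ => ⟨-k, by omega⟩⟩

variable {q : ℝ}

theorem euler_hasSum (h0 : 0 < q) (h1 : q < 1) {M : ℝ} (hM : 0 < M) (a : ℝ) :
    HasSum (fun k : ℕ => q ^ (M * ((k : ℝ) * (k - 1) / 2) + a * k) / qPochFinR (q ^ M) (q ^ M) k)
      (qPochInfR (-(q ^ a)) (q ^ M)) := by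
  have hQ0 : 0 < q ^ M := Real.rpow_pos_of_pos h0 M
  have hQ1 : q ^ M < 1 := Real.rpow_lt_one h0.le h1 hM
  have h := hasSum_phiTerm (α := 0) (β := 1) (γ := q ^ a) hQ0 hQ1 le_rfl zero_le_one
    (Real.rpow_pos_of_pos h0 a).le (by simp)
  have hz : qPochInfR 0 (q ^ M) = 1 := by simp [qPochInfR]
  rw [zero_mul, hz, one_mul, div_one] at h
  refine h.congr_fun fun k => ?_
  induction k with
  | zero => simp [phiTerm, qPochFinR]
  | succ k ih =>
    have e1 := one_sub_pow_succ_pos hQ0 hQ1 k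
    have p1 := qPochFinR_pos hQ0 hQ1 hQ1 k
    have hx : q ^ (M * (((k + 1 : ℕ) : ℝ) * ((k + 1 : ℕ) - 1) / 2) + a * (k + 1 : ℕ)) =
        q ^ (M * ((k : ℝ) * (k - 1) / 2) + a * k) * ((q ^ M) ^ k * q ^ a) := by
      rw [← Real.rpow_natCast (q ^ M), ← Real.rpow_mul h0.le, ← Real.rpow_add h0,
        ← Real.rpow_add h0]
      congr 1
      push_cast
      ring
    rw [phiTerm_succ, ← ih, qPochFinR_succ, hx, ← pow_succ']
    simp only [zero_mul, add_zero, sub_zero, mul_one, one_mul]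
    field_simp

theorem durfee_hasSum {Q : ℝ} (h0 : 0 < Q) (h1 : Q < 1) (d : ℕ) :
    HasSum (fun t : ℕ => Q ^ (t * (t + d)) / (qPochFinR Q Q t * qPochFinR Q Q (t + d)))
      (1 / qPochInfR Q Q) := by
  have h := hasSum_phiTerm (α := 1) (β := 0) (γ := Q ^ (d + 1)) h0 h1 zero_le_one le_rfl
    (by positivity) (by simpa using pow_lt_one₀ h0.le h1 d.succ_ne_zero)
  have hz : qPochInfR 0 Q = 1 := by simp [qPochInfR]
  rw [zero_mul, neg_zero, hz, one_mul] at h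
  have hd := (qPochFinR_pos h0 h1 h1 d).ne'
  have hsplit := qPochInfR_split h0 h1 Q d
  rw [← pow_succ'] at hsplit
  have h := h.div_const (qPochFinR Q Q d)
  rw [div_div, mul_comm (qPochInfR _ _), ← hsplit] at h
  refine h.congr_fun fun t => ?_
  induction t with
  | zero => simp [phiTerm, qPochFinR]
  | succ t ih =>
    have e1 := one_sub_pow_succ_pos h0 h1 t
    have e2 := one_sub_pow_succ_pos h0 h1 (t + d)
    have p1 := qPochFinR_pos h0 h1 h1 t
    have p2 := qPochFinR_pos h0 h1 h1 (t + d)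
    rw [phiTerm_succ, mul_div_right_comm, ← ih, show t + 1 + d = t + d + 1 by ring,
      qPochFinR_succ, qPochFinR_succ, ← pow_succ', ← pow_succ',
      show 1 * Q ^ (d + 1) * Q ^ t = Q ^ (t + d + 1) by ring]
    field_simp
    ring

theorem jacobi_triple_product (h0 : 0 < q) (h1 : q < 1) {M : ℝ} (hM : 0 < M) (a : ℝ) :
    HasSum (fun n : ℤ => q ^ (M * ((n : ℝ) * (n - 1) / 2) + a * n)) (JbarR q a M) := by
  have hQ0 : 0 < q ^ M := Real.rpow_pos_of_pos h0 M
  have hQ1 : q ^ M < 1 := Real.rpow_lt_one h0.le h1 hM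
  have s1 := euler_hasSum h0 h1 hM a
  have s2 := euler_hasSum h0 h1 hM (M - a)
  set e1 : ℕ → ℝ := fun k : ℕ =>
    q ^ (M * ((k : ℝ) * (k - 1) / 2) + a * k) / qPochFinR (q ^ M) (q ^ M) k with he1
  set e2 : ℕ → ℝ := fun k : ℕ =>
    q ^ (M * ((k : ℝ) * (k - 1) / 2) + (M - a) * k) / qPochFinR (q ^ M) (q ^ M) k with he2
  have n1 : ∀ k, 0 ≤ e1 k := fun k =>
    div_nonneg (Real.rpow_pos_of_pos h0 _).le (qPochFinR_pos hQ0 hQ1 hQ1 k).le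
  have n2 : ∀ k, 0 ≤ e2 k := fun k =>
    div_nonneg (Real.rpow_pos_of_pos h0 _).le (qPochFinR_pos hQ0 hQ1 hQ1 k).le
  have hprod : HasSum (fun p : ℕ × ℕ => e1 p.1 * e2 p.2) _ :=
    hasSum_prod_of_nonneg (fun p => mul_nonneg (n1 _) (n2 _)) (fun i => s2.mul_left (e1 i))
      (s1.mul_right _)
  have hfib := (diffMinEquiv.hasSum_iff.2 hprod).prod_fiberwise
    (g := fun d : ℤ => q ^ (M * ((d : ℝ) * (d - 1) / 2) + a * d) * (1 / qPochInfR (q ^ M) (q ^ M)))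
    fun d => by
      refine HasSum.congr_fun ((durfee_hasSum hQ0 hQ1 d.natAbs).mul_left _) fun t => ?_
      have hpow : ∀ n : ℕ, (q ^ M) ^ n = q ^ (M * n) := fun n => by
        rw [← Real.rpow_natCast, ← Real.rpow_mul h0.le]
      simp only [he1, he2, Function.comp_apply, diffMinEquiv, Equiv.coe_fn_mk, hpow]
      rw [div_mul_div_comm, ← mul_div_assoc (q ^ (_ : ℝ)), ← Real.rpow_add h0, ← Real.rpow_add h0]
      obtain ⟨n, rfl | rfl⟩ := d.eq_nat_or_neg
      · simp only [Int.toNat_natCast, Int.toNat_neg_natCast, Int.natAbs_natCast, add_zero]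
        congr 1
        · congr 1
          push_cast
          ring
        · ring
      · simp only [Int.toNat_natCast, Int.toNat_neg_natCast, Int.natAbs_neg, Int.natAbs_natCast,
          neg_neg, add_zero]
        congr 2
        push_cast
        ring
  have hP := (qPochInfR_pos hQ0 hQ1 hQ1).ne'
  have := hfib.mul_right (qPochInfR (q ^ M) (q ^ M))
  simpa only [JbarR, one_div, inv_mul_cancel_right₀ hP] using this

end DoubleSums

section ProductIdentities
open Filter

theorem qPochFinR_mul_neg (a x : ℝ) (n : ℕ) :
    qPochFinR a x n * qPochFinR (-a) x n = qPochFinR (a ^ 2) (x ^ 2) n := by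
  unfold qPochFinR
  rw [← Finset.prod_mul_distrib]
  exact Finset.prod_congr rfl fun k _ => by rw [← pow_mul]; ring

theorem qPochInfR_mul_neg {x : ℝ} (h0 : 0 < x) (h1 : x < 1) (a : ℝ) :
    qPochInfR a x * qPochInfR (-a) x = qPochInfR (a ^ 2) (x ^ 2) := by
  have l1 := (tendsto_qPochFinR h0 h1 a).mul (tendsto_qPochFinR h0 h1 (-a))
  simp only [qPochFinR_mul_neg] at l1
  exact tendsto_nhds_unique l1
    (tendsto_qPochFinR (pow_pos h0 2) (pow_lt_one₀ h0.le h1 two_ne_zero) _)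

theorem qPochFinR_two_mul (a x : ℝ) (n : ℕ) :
    qPochFinR a x (2 * n) = qPochFinR a (x ^ 2) n * qPochFinR (a * x) (x ^ 2) n := by
  induction n with
  | zero => simp [qPochFinR]
  | succ n ih =>
    rw [show 2 * (n + 1) = 2 * n + 1 + 1 by ring, qPochFinR_succ, qPochFinR_succ, ih,
      qPochFinR_succ, qPochFinR_succ, ← pow_mul]
    ring

theorem qPochInfR_dissect {x : ℝ} (h0 : 0 < x) (h1 : x < 1) (a : ℝ) :
    qPochInfR a x = qPochInfR a (x ^ 2) * qPochInfR (a * x) (x ^ 2) := by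
  have h0' := pow_pos h0 2
  have h1' := pow_lt_one₀ h0.le h1 two_ne_zero
  have l1 := (tendsto_qPochFinR h0 h1 a).comp
    (tendsto_id.const_mul_atTop' (show 0 < 2 by norm_num))
  refine tendsto_nhds_unique l1 ?_
  simp only [Function.comp_def, id, qPochFinR_two_mul]
  exact (tendsto_qPochFinR h0' h1' a).mul (tendsto_qPochFinR h0' h1' _)

variable {q : ℝ}

theorem JR_pos (h0 : 0 < q) (h1 : q < 1) {M : ℝ} (hM : 0 < M) : 0 < JR q M :=
  qPochInfR_pos (Real.rpow_pos_of_pos h0 M) (Real.rpow_lt_one h0.le h1 hM)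
    (Real.rpow_lt_one h0.le h1 hM)

theorem JR_eight (h0 : 0 < q) (h1 : q < 1) :
    JR q 8 = qPochInfR (-(q ^ (4 : ℝ))) (q ^ (4 : ℝ)) * JR q 4 := by
  have := qPochInfR_mul_neg (Real.rpow_pos_of_pos h0 4)
    (Real.rpow_lt_one h0.le h1 (by norm_num : (0 : ℝ) < 4)) (q ^ (4 : ℝ))
  have e : (q ^ (4 : ℝ)) ^ 2 = q ^ (8 : ℝ) := by
    rw [← Real.rpow_natCast, ← Real.rpow_mul h0.le]; norm_num
  rw [e] at this
  rw [JR, JR, ← this, mul_comm]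

theorem JR_four_sq (h0 : 0 < q) (h1 : q < 1) :
    JR q 4 ^ 2 = qPochInfR (-(q ^ (2 : ℝ))) (q ^ (4 : ℝ)) * JR q 2 * JR q 8 := by
  have p2 := Real.rpow_pos_of_pos h0 2
  have p4 := Real.rpow_pos_of_pos h0 4
  have l2 := Real.rpow_lt_one h0.le h1 (by norm_num : (0 : ℝ) < 2)
  have l4 := Real.rpow_lt_one h0.le h1 (by norm_num : (0 : ℝ) < 4)
  have e2 : (q ^ (2 : ℝ)) ^ 2 = q ^ (4 : ℝ) := by
    rw [← Real.rpow_natCast, ← Real.rpow_mul h0.le]; norm_num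
  have e4 : (q ^ (4 : ℝ)) ^ 2 = q ^ (8 : ℝ) := by
    rw [← Real.rpow_natCast, ← Real.rpow_mul h0.le]; norm_num
  have d2 := qPochInfR_dissect p2 l2 (q ^ (2 : ℝ))
  have d4 := qPochInfR_dissect p4 l4 (q ^ (4 : ℝ))
  have hm := qPochInfR_mul_neg p4 l4 (q ^ (2 : ℝ))
  rw [← pow_two, e2] at d2
  rw [← pow_two, e4] at d4
  rw [e2, e4] at hm
  have j2 : JR q 2 = qPochInfR (q ^ (2 : ℝ)) (q ^ (4 : ℝ)) * JR q 4 := d2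
  have j4 : JR q 4 = qPochInfR (q ^ (4 : ℝ)) (q ^ (8 : ℝ)) * JR q 8 := d4
  rw [← hm] at j4
  rw [j2]
  linear_combination JR q 4 * j4

end ProductIdentities

section Fibers

variable {q : ℝ}

/-- The value of `∑_k q^{(N-k)^2 + k^2} / (q^4;q^4)_k`. -/
noncomputable def innerSum (q : ℝ) (N : ℕ) : ℝ :=
  q ^ ((N : ℝ) ^ 2) * qPochInfR (-(q ^ (2 - 2 * (N : ℝ)))) (q ^ (4 : ℝ))

theorem innerSum_add_two (h0 : 0 < q) (h1 : q < 1) (N : ℕ) :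
    innerSum q (N + 2) =
      q ^ (2 * (N : ℝ) + 2) * (1 + q ^ (2 * (N : ℝ) + 2)) * innerSum q N := by
  have p4 := Real.rpow_pos_of_pos h0 4
  have l4 := Real.rpow_lt_one h0.le h1 (by norm_num : (0 : ℝ) < 4)
  have e1 : q ^ (2 - 2 * ((N + 2 : ℕ) : ℝ)) * q ^ (4 : ℝ) = q ^ (2 - 2 * (N : ℝ)) := by
    rw [← Real.rpow_add h0]; congr 1; push_cast; ring
  have e2 : q ^ (((N + 2 : ℕ) : ℝ) ^ 2) =
      q ^ (2 * (N : ℝ) + 2) * q ^ (2 * (N : ℝ) + 2) * q ^ ((N : ℝ) ^ 2) := by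
    rw [← Real.rpow_add h0, ← Real.rpow_add h0]; congr 1; push_cast; ring
  have e3 : q ^ (2 * (N : ℝ) + 2) * q ^ (2 - 2 * ((N + 2 : ℕ) : ℝ)) = 1 := by
    rw [← Real.rpow_add h0, ← Real.rpow_zero q]; congr 1; push_cast; ring
  rw [innerSum, innerSum, qPochInfR_step p4 l4, neg_mul, e1, e2]
  linear_combination q ^ (2 * (N : ℝ) + 2) * q ^ ((N : ℝ) ^ 2) *
    qPochInfR (-(q ^ (2 - 2 * (N : ℝ)))) (q ^ (4 : ℝ)) * e3

theorem innerSum_nonneg (h0 : 0 < q) (h1 : q < 1) (N : ℕ) : 0 ≤ innerSum q N := by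
  have := qPochInfR_pos (a := -(q ^ (2 - 2 * (N : ℝ)))) (Real.rpow_pos_of_pos h0 4)
    (Real.rpow_lt_one h0.le h1 (by norm_num : (0 : ℝ) < 4))
    (by linarith [Real.rpow_pos_of_pos h0 (2 - 2 * (N : ℝ))])
  have := Real.rpow_pos_of_pos h0 ((N : ℝ) ^ 2)
  unfold innerSum
  positivity

/-- `(q^4;q^4)_∞` times the sum over pairs `(i, j)` with `|i - j| = d`, `i ≥ j`. -/
noncomputable def fiberSum (q : ℝ) (d : ℕ) : ℝ :=
  innerSum q d * qPochInfR (-(q ^ (2 * (d : ℝ) + 2))) (q ^ (4 : ℝ))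

theorem fiberSum_add_two (h0 : 0 < q) (h1 : q < 1) (d : ℕ) :
    fiberSum q (d + 2) = q ^ (2 * (d : ℝ) + 2) * fiberSum q d := by
  have p4 := Real.rpow_pos_of_pos h0 4
  have l4 := Real.rpow_lt_one h0.le h1 (by norm_num : (0 : ℝ) < 4)
  have e1 : q ^ (2 * (d : ℝ) + 2) * q ^ (4 : ℝ) = q ^ (2 * ((d + 2 : ℕ) : ℝ) + 2) := by
    rw [← Real.rpow_add h0]; congr 1; push_cast; ring
  rw [fiberSum, fiberSum, innerSum_add_two h0 h1, qPochInfR_step p4 l4 (-(q ^ (2 * (d : ℝ) + 2))),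
    neg_mul, e1]
  ring

theorem fiberSum_even (h0 : 0 < q) (h1 : q < 1) (n : ℕ) :
    fiberSum q (2 * n) = q ^ (2 * (n : ℝ) ^ 2) * fiberSum q 0 := by
  induction n with
  | zero => simp
  | succ n ih =>
    rw [mul_add, mul_one, fiberSum_add_two h0 h1, ih, ← mul_assoc, ← Real.rpow_add h0]
    congr 2
    push_cast
    ring

theorem fiberSum_odd (h0 : 0 < q) (h1 : q < 1) (n : ℕ) :
    fiberSum q (2 * n + 1) = q ^ (2 * (n : ℝ) ^ 2 + 2 * n) * fiberSum q 1 := by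
  induction n with
  | zero => simp
  | succ n ih =>
    rw [show 2 * (n + 1) + 1 = 2 * n + 1 + 2 by ring, fiberSum_add_two h0 h1, ih, ← mul_assoc,
      ← Real.rpow_add h0]
    congr 2
    push_cast
    ring

theorem fiberSum_natAbs_even (h0 : 0 < q) (h1 : q < 1) (n : ℤ) :
    fiberSum q (2 * n).natAbs = q ^ (2 * (n : ℝ) ^ 2) * fiberSum q 0 := by
  rw [Int.natAbs_mul]
  refine (fiberSum_even h0 h1 _).trans ?_
  rw [Nat.cast_natAbs, Int.cast_abs, sq_abs]

theorem fiberSum_natAbs_odd (h0 : 0 < q) (h1 : q < 1) (n : ℤ) :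
    fiberSum q (1 - 2 * n).natAbs = q ^ (2 * (n : ℝ) ^ 2 - 2 * n) * fiberSum q 1 := by
  rcases le_or_gt n 0 with hn | hn
  · obtain ⟨k, rfl⟩ := Int.eq_ofNat_of_zero_le (neg_nonneg.2 hn) |>.imp
      fun k hk => neg_eq_iff_eq_neg.1 hk
    rw [show (1 - 2 * -(k : ℤ)).natAbs = 2 * k + 1 by omega, fiberSum_odd h0 h1]
    congr 2
    push_cast
    ring
  · obtain ⟨k, rfl⟩ := Int.eq_ofNat_of_zero_le (Int.sub_nonneg_of_le hn) |>.imp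
      fun k hk => (sub_eq_iff_eq_add.1 hk)
    rw [show (1 - 2 * ((k : ℤ) + (0 + 1))).natAbs = 2 * k + 1 by omega, fiberSum_odd h0 h1]
    congr 2
    push_cast
    ring

theorem fiberSum_zero : fiberSum q 0 = qPochInfR (-(q ^ (2 : ℝ))) (q ^ (4 : ℝ)) ^ 2 := by
  simp [fiberSum, innerSum, pow_two]

theorem fiberSum_one (h0 : 0 < q) (h1 : q < 1) :
    fiberSum q 1 = 2 * q * qPochInfR (-(q ^ (4 : ℝ))) (q ^ (4 : ℝ)) ^ 2 := by
  have := qPochInfR_step (Real.rpow_pos_of_pos h0 4)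
    (Real.rpow_lt_one h0.le h1 (by norm_num : (0 : ℝ) < 4)) (-1)
  rw [neg_one_mul] at this
  rw [fiberSum, innerSum, Nat.cast_one, show (2 : ℝ) - 2 * 1 = 0 by norm_num,
    show (2 : ℝ) * 1 + 2 = 4 by norm_num, one_pow, Real.rpow_one, Real.rpow_zero, this]
  ring

theorem hasSum_fiberSum (h0 : 0 < q) (h1 : q < 1) (d : ℕ) :
    HasSum (fun t : ℕ => innerSum q (d + 2 * t) /
      (qPochFinR (q ^ (4 : ℝ)) (q ^ (4 : ℝ)) t * qPochFinR (q ^ (4 : ℝ)) (q ^ (4 : ℝ)) (t + d)))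
      (fiberSum q d / JR q 4) := by
  have p4 := Real.rpow_pos_of_pos h0 4
  have l4 := Real.rpow_lt_one h0.le h1 (by norm_num : (0 : ℝ) < 4)
  have pd := Real.rpow_pos_of_pos h0 (2 * (d : ℝ) + 2)
  have hQ : ∀ n : ℕ, (q ^ (4 : ℝ)) ^ n = q ^ (4 * (n : ℝ)) := fun n => by
    rw [← Real.rpow_natCast, ← Real.rpow_mul h0.le]
  have hαγ : q ^ (2 * (d : ℝ) + 2) * q ^ (2 * (d : ℝ) + 2) = (q ^ (4 : ℝ)) ^ (d + 1) := by
    rw [hQ, ← Real.rpow_add h0]; congr 1; push_cast; ring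
  have h := hasSum_phiTerm (α := q ^ (2 * (d : ℝ) + 2)) (β := 1) (γ := q ^ (2 * (d : ℝ) + 2)) p4 l4
    pd.le zero_le_one pd.le (by rw [hαγ]; exact pow_lt_one₀ p4.le l4 d.succ_ne_zero)
  have hd := (qPochFinR_pos p4 l4 l4 d).ne'
  have hsplit := qPochInfR_split p4 l4 (q ^ (4 : ℝ)) d
  rw [← pow_succ'] at hsplit
  have h := (h.div_const (qPochFinR (q ^ (4 : ℝ)) (q ^ (4 : ℝ)) d)).mul_left (innerSum q d)
  rw [div_div, hαγ, mul_comm (qPochInfR ((q ^ (4 : ℝ)) ^ (d + 1)) _), ← hsplit, one_mul,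
    ← mul_div_assoc] at h
  refine h.congr_fun fun t => ?_
  induction t with
  | zero => simp [phiTerm, qPochFinR, div_eq_mul_inv]
  | succ t ih =>
    have e1 := one_sub_pow_succ_pos p4 l4 t
    have e2 := one_sub_pow_succ_pos p4 l4 (t + d)
    have p1 := qPochFinR_pos p4 l4 l4 t
    have p2 := qPochFinR_pos p4 l4 l4 (t + d)
    have e5 : q ^ (2 * ((d + 2 * t : ℕ) : ℝ) + 2) =
        (q ^ (4 : ℝ)) ^ t * q ^ (2 * (d : ℝ) + 2) := by
      rw [hQ, ← Real.rpow_add h0]; congr 1; push_cast; ring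
    rw [phiTerm_succ, mul_div_right_comm, ← mul_assoc, ← ih, show t + 1 + d = t + d + 1 by ring,
      qPochFinR_succ, qPochFinR_succ, ← pow_succ', ← pow_succ', hαγ, ← pow_add,
      show d + 1 + t = t + d + 1 by ring, show d + 2 * (t + 1) = d + 2 * t + 2 by ring,
      innerSum_add_two h0 h1, e5]
    field_simp

theorem hasSum_innerSum (h0 : 0 < q) (h1 : q < 1) (N : ℕ) :
    HasSum (fun k : ℕ => q ^ ((N : ℝ) ^ 2 + 2 * (k : ℝ) ^ 2 - 2 * (N : ℝ) * k) /
      qPochFinR (q ^ (4 : ℝ)) (q ^ (4 : ℝ)) k) (innerSum q N) := by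
  refine ((euler_hasSum h0 h1 (by norm_num : (0 : ℝ) < 4) (2 - 2 * (N : ℝ))).mul_left
    (q ^ ((N : ℝ) ^ 2))).congr_fun fun k => ?_
  rw [← mul_div_assoc (q ^ (_ : ℝ)), ← Real.rpow_add h0]
  congr 2
  ring

theorem hasSum_pairs (h0 : 0 < q) (h1 : q < 1) {m : ℝ} (hm : 0 < m) (ν : ℝ) :
    HasSum (fun p : ℕ × ℕ => q ^ (2 * m * ((p.1 : ℝ) - p.2) ^ 2 + ν * ((p.1 : ℝ) - p.2)) *
        (innerSum q (p.1 + p.2) / (qPochFinR (q ^ (4 : ℝ)) (q ^ (4 : ℝ)) p.1 *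
          qPochFinR (q ^ (4 : ℝ)) (q ^ (4 : ℝ)) p.2)))
      (JbarR q (2 * (4 * m + ν + 1)) (4 * (4 * m + 1)) * (fiberSum q 0 / JR q 4) +
        JbarR q (-(2 * ν)) (4 * (4 * m + 1)) *
          (q ^ (2 * m + ν) * (fiberSum q 1 / JR q 4))) := by
  have p4 := Real.rpow_pos_of_pos h0 4
  have l4 := Real.rpow_lt_one h0.le h1 (by norm_num : (0 : ℝ) < 4)
  have hM : 0 < 4 * (4 * m + 1) := by positivity
  refine diffMinEquiv.hasSum_iff.1 (hasSum_prod_of_nonneg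
    (g := fun d : ℤ => q ^ (2 * m * (d : ℝ) ^ 2 + ν * d) * (fiberSum q d.natAbs / JR q 4))
    (fun p => ?_) (fun d => ?_) (hasSum_int_of_even_odd ?_ ?_))
  · exact mul_nonneg (Real.rpow_pos_of_pos h0 _).le (div_nonneg (innerSum_nonneg h0 h1 _)
      (mul_pos (qPochFinR_pos p4 l4 l4 _) (qPochFinR_pos p4 l4 l4 _)).le)
  · refine ((hasSum_fiberSum h0 h1 d.natAbs).mul_left _).congr_fun fun t => ?_
    simp only [Function.comp_apply, diffMinEquiv, Equiv.coe_fn_mk]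
    obtain ⟨n, rfl | rfl⟩ := d.eq_nat_or_neg
    · simp only [Int.toNat_natCast, Int.toNat_neg_natCast, Int.natAbs_natCast, add_zero]
      rw [show t + n + t = n + 2 * t by ring, mul_comm (qPochFinR _ _ (t + n))]
      congr 2
      push_cast
      ring
    · simp only [Int.toNat_natCast, Int.toNat_neg_natCast, Int.natAbs_neg, Int.natAbs_natCast,
        neg_neg, add_zero]
      rw [show t + (t + n) = n + 2 * t by ring]
      congr 2
      push_cast
      ring
  · refine ((jacobi_triple_product h0 h1 hM _).mul_right _).congr_fun fun n => ?_
    rw [fiberSum_natAbs_even h0 h1, mul_div_assoc, ← mul_assoc, ← Real.rpow_add h0]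
    congr 2
    push_cast
    ring
  · refine ((jacobi_triple_product h0 h1 hM _).mul_right _).congr_fun fun n => ?_
    rw [fiberSum_natAbs_odd h0 h1, mul_div_assoc, ← mul_assoc, ← mul_assoc, ← Real.rpow_add h0,
      ← Real.rpow_add h0]
    congr 2
    push_cast
    ring

end Fibers

theorem stmt2 (q : ℝ) (hq0 : 0 < q) (hq1 : q < 1) (m ν : ℚ) (hm : 0 < m) :
    (∑' (i : ℕ) (j : ℕ) (k : ℕ),
      q ^ (2*(m:ℝ)*((i:ℝ)-(j:ℝ))^2 + ((i:ℝ)+(j:ℝ))^2 + 2*(k:ℝ)^2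
            - 2*((i:ℝ)+(j:ℝ))*(k:ℝ) + (ν:ℝ)*((i:ℝ)-(j:ℝ))) /
        (qPochFinR (q ^ (4:ℕ)) (q ^ (4:ℕ)) i * qPochFinR (q ^ (4:ℕ)) (q ^ (4:ℕ)) j *
          qPochFinR (q ^ (4:ℕ)) (q ^ (4:ℕ)) k)) =
    JR q 4 ^ 3 * JbarR q (2*(4*(m:ℝ)+(ν:ℝ)+1)) (4*(4*(m:ℝ)+1)) / (JR q 2 ^ 2 * JR q 8 ^ 2)
    + 2 * q ^ (2*(m:ℝ)+(ν:ℝ)+1) * JR q 8 ^ 2 * JbarR q (-(2*(ν:ℝ))) (4*(4*(m:ℝ)+1)) /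
        JR q 4 ^ 3 := by
  have hm' : (0 : ℝ) < m := by exact_mod_cast hm
  have hpow : q ^ (4 : ℕ) = q ^ (4 : ℝ) := by
    rw [← Real.rpow_natCast]; norm_num
  have inner : ∀ i j : ℕ, ∑' k : ℕ,
      q ^ (2*(m:ℝ)*((i:ℝ)-(j:ℝ))^2 + ((i:ℝ)+(j:ℝ))^2 + 2*(k:ℝ)^2
            - 2*((i:ℝ)+(j:ℝ))*(k:ℝ) + (ν:ℝ)*((i:ℝ)-(j:ℝ))) /
        (qPochFinR (q ^ (4:ℕ)) (q ^ (4:ℕ)) i * qPochFinR (q ^ (4:ℕ)) (q ^ (4:ℕ)) j *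
          qPochFinR (q ^ (4:ℕ)) (q ^ (4:ℕ)) k) =
      q ^ (2 * (m : ℝ) * ((i : ℝ) - j) ^ 2 + (ν : ℝ) * ((i : ℝ) - j)) *
        (innerSum q (i + j) / (qPochFinR (q ^ (4 : ℝ)) (q ^ (4 : ℝ)) i *
          qPochFinR (q ^ (4 : ℝ)) (q ^ (4 : ℝ)) j)) := by
    intro i j
    refine ((((hasSum_innerSum hq0 hq1 (i + j)).div_const _).mul_left _).congr_fun
      fun k => ?_).tsum_eq
    rw [hpow, div_div, ← mul_div_assoc (q ^ (_ : ℝ)), ← Real.rpow_add hq0,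
      mul_comm (qPochFinR _ _ k)]
    congr 2
    push_cast
    ring
  have hs := hasSum_pairs hq0 hq1 hm' (ν : ℝ)
  simp only [inner]
  rw [← hs.summable.tsum_prod, hs.tsum_eq, fiberSum_zero, fiberSum_one hq0 hq1]
  have h2 := JR_pos hq0 hq1 (by norm_num : (0 : ℝ) < 2)
  have h4 := JR_pos hq0 hq1 (by norm_num : (0 : ℝ) < 4)
  have h8 := JR_pos hq0 hq1 (by norm_num : (0 : ℝ) < 8)
  have e1 : qPochInfR (-(q ^ (2 : ℝ))) (q ^ (4 : ℝ)) = JR q 4 ^ 2 / (JR q 2 * JR q 8) := by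
    rw [eq_div_iff (by positivity), JR_four_sq hq0 hq1, mul_assoc]
  have e2 : qPochInfR (-(q ^ (4 : ℝ))) (q ^ (4 : ℝ)) = JR q 8 / JR q 4 := by
    rw [eq_div_iff h4.ne', JR_eight hq0 hq1]
  rw [e1, e2, Real.rpow_add hq0 _ 1, Real.rpow_one]
  field_simp
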